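/- With the labeling F as above, the rook monoid R_n with the Bruhat–Chevalley–Renner order is EL-shellable: in every interval the unique increasing maximal chain is also the lexicographically first among all maximal chains of that interval. -/

import Mathlib

open Finset

variable {n : ℕ}

/-- An element of the rook monoid `R_n` in one-line notation: a sequence of
entries in `{0,...,n}` whose nonzero entries are pairwise distinct. -/
def IsRook (n : ℕ) (a : Fin n → ℕ) : Prop :=
  (∀ i, a i ≤ n) ∧ ∀ i j, a i ≠ 0 → a i = a j → i = j

/-- number of inversions -/
def rinv (a : Fin n → ℕ) : ℕ :=
  ((univ ×ˢ univ).filter fun p : Fin n × Fin n => p.1 < p.2 ∧ a p.2 < a p.1).card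

/-- number of coinversion pairs -/
def rcoinv (a : Fin n → ℕ) : ℕ :=
  ((univ ×ˢ univ).filter fun p : Fin n × Fin n => p.1 < p.2 ∧ 0 < a p.1 ∧ a p.1 < a p.2).card

/-- the length function ℓ -/
def rlen (a : Fin n → ℕ) : ℕ := (∑ i, a i) + rinv a

/-- type 1 generating relation: increase a single entry -/
def Step1 (a b : Fin n → ℕ) : Prop := ∃ i, a i < b i ∧ ∀ j, j ≠ i → a j = b j

/-- type 2 generating relation: swap two entries, larger one first -/
def Step2 (a b : Fin n → ℕ) : Prop :=
  ∃ i j, i < j ∧ a i < a j ∧ b i = a j ∧ b j = a i ∧ ∀ k, k ≠ i → k ≠ j → a k = b k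

/-- the Bruhat-Chevalley-Renner order on `R_n` -/
def RookLe (n : ℕ) (a b : Fin n → ℕ) : Prop :=
  Relation.ReflTransGen (fun x y => IsRook n x ∧ IsRook n y ∧ (Step1 x y ∨ Step2 x y)) a b

def RookLt (n : ℕ) (a b : Fin n → ℕ) : Prop := RookLe n a b ∧ a ≠ b

/-- covering relation of the Bruhat-Chevalley-Renner order -/
def RookCov (n : ℕ) (a b : Fin n → ℕ) : Prop :=
  RookLt n a b ∧ ∀ z, RookLt n a z → RookLt n z b → False

/-- the edge labeling `F` on covering relations -/
noncomputable def Flabel (a b : Fin n → ℕ) : ℕ × ℕ := by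
  classical
  exact if h : ∃ i, a i < b i ∧ ∀ j, j ≠ i → a j = b j then (a h.choose, b h.choose)
  else if h2 : ∃ p : Fin n × Fin n, p.1 < p.2 ∧ a p.1 < a p.2 ∧ b p.1 = a p.2 ∧ b p.2 = a p.1 ∧
      ∀ k, k ≠ p.1 → k ≠ p.2 → a k = b k then (a h2.choose.1, a h2.choose.2)
  else (0, 0)

/-- lexicographic (strict) order on labels -/
def pairLt (p q : ℕ × ℕ) : Prop := p.1 < q.1 ∨ (p.1 = q.1 ∧ p.2 < q.2)

def pairLe (p q : ℕ × ℕ) : Prop := p = q ∨ pairLt p q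

/-- lexicographic comparison of label sequences -/
def lexLe (l m : List (ℕ × ℕ)) : Prop := l = m ∨ List.Lex pairLt l m

/-- the Jordan-Hölder sequence of labels of a chain -/
noncomputable def labels (c : List (Fin n → ℕ)) : List (ℕ × ℕ) :=
  List.zipWith Flabel c c.tail

/-- a maximal chain in the interval `[x,y]` -/
def RookMaxChain (n : ℕ) (x y : Fin n → ℕ) (c : List (Fin n → ℕ)) : Prop :=
  c.Chain' (RookCov n) ∧ c.head? = some x ∧ c.getLast? = some y

/-- The number of positions before `i` carrying an entry at least `k`. -/
def rookRank (x : Fin n → ℕ) (i k : ℕ) : ℕ :=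
  ∑ j : Fin n, if j.val < i ∧ k ≤ x j then 1 else 0

/-- The pointwise order on rank functions. -/
def RankLe (x y : Fin n → ℕ) : Prop :=
  ∀ i k, i ≤ n → rookRank x i k ≤ rookRank y i k

/-- The value `b` sits at position `q` of `x`; a missing value sits at position `n`. -/
def IsLoc (x : Fin n → ℕ) (q b : ℕ) : Prop :=
  (∃ h : q < n, x ⟨q, h⟩ = b) ∨ (q = n ∧ ∀ j, x j ≠ b)

/-- Exchange the entry at `p` with the value `b` located at `q`. -/
def move (x : Fin n → ℕ) (p : Fin n) (q b : ℕ) : Fin n → ℕ :=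
  fun j => if j = p then b else if j.val = q then x p else x j

/-- The conditions under which `move x p q b` is a generating relation of the order. -/
structure IsMove (x : Fin n → ℕ) (p : Fin n) (q b : ℕ) : Prop where
  lt_val : x p < b
  val_le : b ≤ n
  lt_pos : p.val < q
  loc : IsLoc x q b

theorem IsMove.pos_le {x : Fin n → ℕ} {p : Fin n} {q b : ℕ} (h : IsMove x p q b) : q ≤ n := by
  rcases h.loc with ⟨h, -⟩ | ⟨h, -⟩ <;> omega

theorem move_self (x : Fin n → ℕ) (p : Fin n) (q b : ℕ) : move x p q b p = b := by
  simp [move]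

theorem rookRank_zero (x : Fin n → ℕ) (k : ℕ) : rookRank x 0 k = 0 := by
  simp [rookRank]

theorem rookRank_succ (x : Fin n → ℕ) {i : ℕ} (h : i < n) (k : ℕ) :
    rookRank x (i + 1) k = rookRank x i k + if k ≤ x ⟨i, h⟩ then 1 else 0 := by
  have key : ∀ j : Fin n, (if j.val < i + 1 ∧ k ≤ x j then 1 else 0) =
      (if j.val < i ∧ k ≤ x j then 1 else 0) +
        if j = ⟨i, h⟩ then (if k ≤ x j then 1 else 0) else 0 := by
    intro j
    simp only [Fin.ext_iff]
    split_ifs <;> omega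
  simp only [rookRank, key, Finset.sum_add_distrib, Finset.sum_ite_eq', Finset.mem_univ, if_true]

theorem rookRank_zero_right (x : Fin n → ℕ) {i : ℕ} (hi : i ≤ n) : rookRank x i 0 = i := by
  induction i with
  | zero => exact rookRank_zero x 0
  | succ i ih => simp [rookRank_succ x hi, ih (by omega)]

/-- Passing from threshold `k + 1` to `k` adds the entry `k`, if present. -/
theorem rookRank_eq_succ {x : Fin n → ℕ} (hx : IsRook n x) {i k : ℕ} (hi : i ≤ n) (hk : 0 < k) :
    rookRank x i k = rookRank x i (k + 1) +
      if ∃ j : Fin n, j.val < i ∧ x j = k then 1 else 0 := by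
  induction i with
  | zero => simp [rookRank_zero]
  | succ i ih =>
    have hi' : i < n := hi
    rw [rookRank_succ x hi', rookRank_succ x hi', ih hi'.le]
    by_cases hxi : x ⟨i, hi'⟩ = k
    · have h1 : ¬ ∃ j : Fin n, j.val < i ∧ x j = k := by
        rintro ⟨j, hj, hjk⟩
        have := hx.2 j ⟨i, hi'⟩ (by omega) (by omega)
        subst this
        exact lt_irrefl _ hj
      have h2 : ∃ j : Fin n, j.val < i + 1 ∧ x j = k := ⟨⟨i, hi'⟩, by simp, hxi⟩
      simp only [h1, h2, if_true, if_false]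
      split_ifs <;> omega
    · have h1 : (∃ j : Fin n, j.val < i + 1 ∧ x j = k) ↔ ∃ j : Fin n, j.val < i ∧ x j = k := by
        constructor
        · rintro ⟨j, hj, hjk⟩
          refine ⟨j, lt_of_le_of_ne (by omega) ?_, hjk⟩
          rintro rfl
          exact hxi hjk
        · rintro ⟨j, hj, hjk⟩
          exact ⟨j, by omega, hjk⟩
      simp only [h1]
      split_ifs <;> omega

theorem rookRank_move {x : Fin n → ℕ} {p : Fin n} {q b : ℕ} (h : IsMove x p q b) {i : ℕ}
    (hi : i ≤ n) (k : ℕ) : rookRank (move x p q b) i k = rookRank x i k +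
      if p.val < i ∧ i ≤ q ∧ x p < k ∧ k ≤ b then 1 else 0 := by
  obtain ⟨h1, -, h3, h4⟩ := h
  induction i with
  | zero => simp [rookRank_zero]
  | succ i ih =>
    have hi' : i < n := hi
    rw [rookRank_succ _ hi', rookRank_succ _ hi', ih hi'.le]
    have hq : i = q → x ⟨i, hi'⟩ = b := by
      rintro rfl
      rcases h4 with ⟨_, h⟩ | ⟨h, -⟩
      · exact h
      · omega
    have hp : i = p.val → x ⟨i, hi'⟩ = x p := fun h => congrArg x (Fin.ext h)
    simp only [move, Fin.ext_iff]
    split_ifs <;> omega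

theorem RankLe.refl (x : Fin n → ℕ) : RankLe x x := fun _ _ _ => le_rfl

theorem RankLe.trans {x y z : Fin n → ℕ} (h : RankLe x y) (h' : RankLe y z) : RankLe x z :=
  fun i k hi => (h i k hi).trans (h' i k hi)

theorem eq_of_rookRank_eq {x y : Fin n → ℕ}
    (h : ∀ i k, i ≤ n → rookRank x i k = rookRank y i k) : x = y := by
  funext j
  have key : ∀ k, k ≤ x j ↔ k ≤ y j := by
    intro k
    have h1 := h j k j.2.le
    have h2 := h (j + 1) k j.2
    rw [rookRank_succ _ j.2, rookRank_succ _ j.2, h1] at h2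
    by_cases c1 : k ≤ x j <;> by_cases c2 : k ≤ y j <;> simp [c1, c2] at h2 ⊢
  exact le_antisymm ((key _).1 le_rfl) ((key _).2 le_rfl)

theorem RankLe.antisymm {x y : Fin n → ℕ} (h : RankLe x y) (h' : RankLe y x) : x = y :=
  eq_of_rookRank_eq fun i k hi => le_antisymm (h i k hi) (h' i k hi)

theorem rankLe_move {x : Fin n → ℕ} {p : Fin n} {q b : ℕ} (h : IsMove x p q b) :
    RankLe x (move x p q b) := by
  intro i k hi
  rw [rookRank_move h hi]
  omega

theorem rookRank_lt_of_move_le {x y : Fin n → ℕ} {p : Fin n} {q b : ℕ} (h : IsMove x p q b)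
    (hy : RankLe (move x p q b) y) {i k : ℕ} (h1 : p.val < i) (h2 : i ≤ q) (h3 : x p < k)
    (h4 : k ≤ b) : rookRank x i k < rookRank y i k := by
  have hi := h2.trans h.pos_le
  have := hy i k hi
  rw [rookRank_move h hi, if_pos ⟨h1, h2, h3, h4⟩] at this
  omega

theorem isRook_move {x : Fin n → ℕ} (hx : IsRook n x) {p : Fin n} {q b : ℕ}
    (h : IsMove x p q b) : IsRook n (move x p q b) := by
  obtain ⟨h1, h2, h3, h4⟩ := h
  have hxb : ∀ j : Fin n, x j = b → j.val = q := by
    intro j hj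
    rcases h4 with ⟨hq, h4⟩ | ⟨-, h4⟩
    · have := hx.2 j ⟨q, hq⟩ (by omega) (by omega)
      rw [this]
    · exact absurd hj (h4 j)
  refine ⟨fun i => ?_, fun i j hi hij => ?_⟩
  · have := hx.1 i
    have := hx.1 p
    simp only [move]
    split_ifs <;> omega
  · have hq := hxb i
    have hq' := hxb j
    have e1 := hx.2 i j
    have e2 := hx.2 p j
    have e3 := hx.2 p i
    simp only [move, Fin.ext_iff] at *
    split_ifs at hi hij <;> omega

theorem move_ne {x : Fin n → ℕ} {p : Fin n} {q b : ℕ} (h : IsMove x p q b) :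
    move x p q b ≠ x := by
  intro e
  have := congrFun e p
  rw [move_self] at this
  exact h.lt_val.ne' this

/-- Two moves from `x` compare exactly as their rectangles do. -/
theorem move_le_move_iff {x : Fin n → ℕ} {p p' : Fin n} {q q' b b' : ℕ} (h : IsMove x p q b)
    (h' : IsMove x p' q' b') : RankLe (move x p q b) (move x p' q' b') ↔
      p'.val ≤ p.val ∧ q ≤ q' ∧ x p' ≤ x p ∧ b ≤ b' := by
  have h1 := h.lt_val
  have h3 := h.lt_pos
  have h4 := h.pos_le
  constructor
  · intro hle
    have c1 := hle (p + 1) (x p + 1) (by omega)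
    have c2 := hle q b h4
    rw [rookRank_move h (by omega), rookRank_move h' (by omega), if_pos (by omega)] at c1 c2
    split_ifs at c1 c2 <;> omega
  · intro hr i k hi
    rw [rookRank_move h hi, rookRank_move h' hi]
    split_ifs <;> omega

theorem rookRank_add_le (x : Fin n → ℕ) {i i' : ℕ} (h : i ≤ i') (h' : i' ≤ n) {k k' : ℕ}
    (hk : k ≤ k') : rookRank x i k + rookRank x i' k' ≤ rookRank x i' k + rookRank x i k' := by
  induction i', h using Nat.le_induction with
  | base => omega
  | succ m hm ih =>
    have := ih (by omega)
    rw [rookRank_succ x h', rookRank_succ x h']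
    split_ifs <;> omega

/-- If every entry at positions `i, …, i' - 1` that is at least `k` is at least `k'`, then both
thresholds gain equally between `i` and `i'`. -/
theorem rookRank_add_eq (x : Fin n → ℕ) {i i' : ℕ} (h : i ≤ i') (h' : i' ≤ n) {k k' : ℕ}
    (hk : k ≤ k') (hx : ∀ j : Fin n, i ≤ j.val → j.val < i' → k ≤ x j → k' ≤ x j) :
    rookRank x i k + rookRank x i' k' = rookRank x i' k + rookRank x i k' := by
  induction i', h using Nat.le_induction with
  | base => omega
  | succ m hm ih =>
    have := ih (by omega) fun j h1 h2 => hx j h1 (by omega)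
    have hm' := hx ⟨m, h'⟩ hm (by simp)
    rw [rookRank_succ x h', rookRank_succ x h']
    split_ifs <;> omega

theorem rookRank_le_add {x : Fin n → ℕ} (hx : IsRook n x) {i k k' : ℕ} (hi : i ≤ n) (hk : 0 < k)
    (hkk : k ≤ k') : rookRank x i k ≤ rookRank x i k' + (k' - k) := by
  induction k', hkk using Nat.le_induction with
  | base => omega
  | succ m hm ih =>
    have := rookRank_eq_succ hx hi (k := m) (by omega)
    split_ifs at this <;> omega

theorem rookRank_eq_add {x : Fin n → ℕ} (hx : IsRook n x) {i k k' : ℕ} (hi : i ≤ n) (hk : 0 < k)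
    (hkk : k ≤ k') (h : ∀ m, k ≤ m → m < k' → ∃ j : Fin n, j.val < i ∧ x j = m) :
    rookRank x i k = rookRank x i k' + (k' - k) := by
  induction k', hkk using Nat.le_induction with
  | base => omega
  | succ m hm ih =>
    have h1 := rookRank_eq_succ hx hi (k := m) (by omega)
    rw [if_pos (h m hm (by omega))] at h1
    have := ih fun m' h2 h3 => h m' h2 (by omega)
    omega

theorem rookRank_eq_zero {x : Fin n → ℕ} (hx : IsRook n x) (i : ℕ) {k : ℕ} (hk : n < k) :
    rookRank x i k = 0 := by
  refine Finset.sum_eq_zero fun j _ => if_neg ?_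
  have := hx.1 j
  omega

/-- The first value and position at which two comparable rank functions differ. -/
theorem exists_first_difference {x y : Fin n → ℕ} (hle : RankLe x y) (hne : x ≠ y) :
    ∃ p : Fin n, (∀ i k, i ≤ n → k ≤ x p → rookRank x i k = rookRank y i k) ∧
      rookRank x (p + 1) (x p + 1) < rookRank y (p + 1) (x p + 1) ∧ x p < y p := by
  classical
  have hA : ∃ a i, i ≤ n ∧ rookRank x i (a + 1) < rookRank y i (a + 1) := by
    by_contra! hcon
    refine hne (eq_of_rookRank_eq fun i k hi => ?_)
    rcases k with _ | k
    · rw [rookRank_zero_right x hi, rookRank_zero_right y hi]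
    · exact le_antisymm (hle i _ hi) (hcon k i hi)
  obtain ⟨a, hB, hmin⟩ : ∃ a, (∃ i, i ≤ n ∧ rookRank x i (a + 1) < rookRank y i (a + 1)) ∧
      ∀ i k, i ≤ n → k ≤ a → rookRank x i k = rookRank y i k := by
    refine ⟨Nat.find hA, Nat.find_spec hA, fun i k hi hk => ?_⟩
    rcases k with _ | k
    · rw [rookRank_zero_right x hi, rookRank_zero_right y hi]
    · have := Nat.find_min hA (m := k) (by omega)
      push Not at this
      exact le_antisymm (hle i _ hi) (this i hi)
  obtain ⟨i, ⟨hi, hlt⟩, hfirst⟩ : ∃ i, (i ≤ n ∧ rookRank x i (a + 1) < rookRank y i (a + 1)) ∧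
      ∀ m < i, ¬ (m ≤ n ∧ rookRank x m (a + 1) < rookRank y m (a + 1)) :=
    ⟨Nat.find hB, Nat.find_spec hB, fun m => Nat.find_min hB⟩
  rcases i with _ | i
  · simp [rookRank_zero] at hlt
  have hin : i < n := hi
  have h1 := hfirst i (by omega)
  have h2 := hmin i a hin.le le_rfl
  have h3 := hmin (i + 1) a hi le_rfl
  have hlt' := hlt
  rw [rookRank_succ _ hin, rookRank_succ _ hin] at hlt h3
  have h4 : x ⟨i, hin⟩ = a ∧ a < y ⟨i, hin⟩ := by
    split_ifs at hlt h3 <;> omega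
  refine ⟨⟨i, hin⟩, ?_, ?_, ?_⟩
  · rw [h4.1]; exact hmin
  · rw [h4.1]; exact hlt'
  · rw [h4.1]; exact h4.2

/-- Below any larger element in the rank order there is a move, of the least possible value. -/
theorem exists_move {x y : Fin n → ℕ} (hx : IsRook n x) (hy : IsRook n y) (hle : RankLe x y)
    (hne : x ≠ y) : ∃ p q b, IsMove x p q b ∧ RankLe (move x p q b) y ∧
      ∀ i k, i ≤ n → k ≤ x p → rookRank x i k = rookRank y i k := by
  classical
  obtain ⟨p, hlow, hp, hpy⟩ := exists_first_difference hle hne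
  have hyn := hy.1 p
  -- `P` ends the run of positions, starting at `p`, on which the ranks above `x p` differ.
  obtain ⟨P, hpP, hPn, hrun, hend⟩ : ∃ P, p.val < P ∧ P ≤ n ∧
      (∀ i, p.val < i → i ≤ P → rookRank x i (x p + 1) < rookRank y i (x p + 1)) ∧
      (P < n → rookRank x (P + 1) (x p + 1) = rookRank y (P + 1) (x p + 1)) := by
    by_cases hall : ∀ i, p.val < i → i ≤ n → rookRank x i (x p + 1) < rookRank y i (x p + 1)
    · exact ⟨n, p.2, le_rfl, hall, fun h => absurd h (lt_irrefl n)⟩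
    · push Not at hall
      obtain ⟨e, ⟨he1, he2, he3⟩, hmin⟩ : ∃ e, (p.val < e ∧ e ≤ n ∧
          rookRank y e (x p + 1) ≤ rookRank x e (x p + 1)) ∧ ∀ m < e, ¬ (p.val < m ∧ m ≤ n ∧
          rookRank y m (x p + 1) ≤ rookRank x m (x p + 1)) :=
        ⟨Nat.find hall, Nat.find_spec hall, fun m => Nat.find_min hall⟩
      have hep : e ≠ p + 1 := by
        rintro rfl
        omega
      refine ⟨e - 1, by omega, by omega, fun i h1 h2 => ?_, fun _ => ?_⟩
      · have := hmin i (by omega)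
        omega
      · rw [Nat.sub_add_cancel (by omega)]
        exact le_antisymm (hle e _ he2) he3
  have hex : ∃ b, x p < b ∧ b ≤ n ∧ ∃ q, p.val < q ∧ q ≤ P ∧ IsLoc x q b := by
    rcases hPn.lt_or_eq with hPlt | rfl
    · have h1 := hrun P hpP le_rfl
      have h2 := hend hPlt
      rw [rookRank_succ _ hPlt, rookRank_succ _ hPlt] at h2
      refine ⟨x ⟨P, hPlt⟩, ?_, hx.1 _, P, hpP, le_rfl, Or.inl ⟨hPlt, rfl⟩⟩
      split_ifs at h2 <;> omega
    · by_contra! hcon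
      have hfull := rookRank_eq_add hx (i := P) le_rfl (k := x p + 1) (k' := P + 1) (by omega)
        (by omega) fun m h1 h2 => by
          by_contra! hm
          exact hcon m (by omega) (by omega) P hpP le_rfl (Or.inr ⟨rfl, fun j => hm j j.2⟩)
      have h1 := rookRank_le_add hy (i := P) le_rfl (k := x p + 1) (k' := P + 1) (by omega)
        (by omega)
      have h2 := hrun P hpP le_rfl
      rw [rookRank_eq_zero hx P P.lt_succ_self] at hfull
      rw [rookRank_eq_zero hy P P.lt_succ_self] at h1
      omega
  obtain ⟨b, ⟨hab, hbn, q, hpq, hqP, hloc⟩, hbmin⟩ : ∃ b, (x p < b ∧ b ≤ n ∧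
      ∃ q, p.val < q ∧ q ≤ P ∧ IsLoc x q b) ∧
      ∀ m < b, ¬ (x p < m ∧ m ≤ n ∧ ∃ q, p.val < q ∧ q ≤ P ∧ IsLoc x q m) :=
    ⟨Nat.find hex, Nat.find_spec hex, fun m => Nat.find_min hex⟩
  have hmv : IsMove x p q b := ⟨hab, hbn, hpq, hloc⟩
  refine ⟨p, q, b, hmv, fun i k hi => ?_, hlow⟩
  rw [rookRank_move hmv hi]
  split_ifs with hr
  swap
  · exact hle i k hi
  obtain ⟨h1, h2, h3, h4⟩ := hr
  have hrun_i := hrun i h1 (by omega)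
  rcases hPn.lt_or_eq with hPlt | rfl
  · have e1 := hend hPlt
    have e2 := hle (P + 1) k hPlt
    have e3 := rookRank_add_le y (i := i) (i' := P + 1) (by omega) hPlt (k := x p + 1) (k' := k)
      (by omega)
    have e4 := rookRank_add_eq x (i := i) (i' := P + 1) (by omega) hPlt (k := x p + 1) (k' := k)
      (by omega) fun j c1 c2 c3 => by
        by_contra! c4
        exact hbmin (x j) (by omega) ⟨c3, hx.1 j, j, by omega, by omega, Or.inl ⟨j.2, rfl⟩⟩
    omega
  · have e1 := rookRank_le_add hy hi (k := x p + 1) (k' := k) (by omega) (by omega)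
    have e2 := rookRank_eq_add hx hi (k := x p + 1) (k' := k) (by omega) (by omega)
      fun m c1 c2 => by
        by_contra! c3
        by_cases c4 : ∃ j, x j = m
        · obtain ⟨j, rfl⟩ := c4
          have c5 : i ≤ j.val := by
            by_contra! c5
            exact c3 j c5 rfl
          exact hbmin (x j) (by omega)
            ⟨c1, by omega, j, by omega, by omega, Or.inl ⟨j.2, rfl⟩⟩
        · push Not at c4
          exact hbmin m (by omega) ⟨c1, by omega, P, hpP, le_rfl, Or.inr ⟨rfl, c4⟩⟩
    omega

/-- A move from `x` to a cover of `x` in the rank order. -/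
structure IsCoverMove (x : Fin n → ℕ) (p : Fin n) (q b : ℕ) : Prop extends IsMove x p q b where
  eq_or_eq : ∀ w, IsRook n w → RankLe x w → RankLe w (move x p q b) → w = x ∨ w = move x p q b

theorem IsCoverMove.move_eq {x : Fin n → ℕ} (hx : IsRook n x) {p p' : Fin n} {q q' b b' : ℕ}
    (h : IsCoverMove x p q b) (h' : IsMove x p' q' b')
    (hr : p.val ≤ p'.val ∧ q' ≤ q ∧ x p ≤ x p' ∧ b' ≤ b) :
    p'.val ≤ p.val ∧ q ≤ q' ∧ x p' ≤ x p ∧ b ≤ b' := by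
  rcases h.eq_or_eq _ (isRook_move hx h') (rankLe_move h')
    ((move_le_move_iff h' h.toIsMove).2 hr) with e | e
  · exact absurd e (move_ne h')
  · exact (move_le_move_iff h.toIsMove h').1 (e ▸ RankLe.refl _)

/-- Every move lies above a covering move whose label is no larger. -/
theorem exists_coverMove {x : Fin n → ℕ} (hx : IsRook n x) {p : Fin n} {q b : ℕ}
    (h : IsMove x p q b) : ∃ p' q' b', IsCoverMove x p' q' b' ∧ x p' = x p ∧ b' ≤ b ∧
      RankLe (move x p' q' b') (move x p q b) := by
  induction hN : q - p.val + (b - x p) using Nat.strong_induction_on generalizing p q b with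
  | _ N ih =>
  subst hN
  have hl := h.lt_val
  have hp := h.lt_pos
  by_cases hcov : IsCoverMove x p q b
  · exact ⟨p, q, b, hcov, rfl, le_rfl, RankLe.refl _⟩
  have hw : ∃ w, IsRook n w ∧ RankLe x w ∧ RankLe w (move x p q b) ∧
      w ≠ x ∧ w ≠ move x p q b := by
    by_contra! hcon
    refine hcov ⟨h, fun w h1 h2 h3 => ?_⟩
    by_contra! h4
    exact h4.2 (hcon w h1 h2 h3 h4.1)
  obtain ⟨w, hwr, hxw, hwz, hwx, hwne⟩ := hw
  obtain ⟨p₁, q₁, b₁, hm, hmw, -⟩ := exists_move hx hwr hxw hwx.symm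
  have hr := (move_le_move_iff hm h).1 (hmw.trans hwz)
  have hns : ¬ (p₁.val ≤ p.val ∧ q ≤ q₁ ∧ x p₁ ≤ x p ∧ b ≤ b₁) := fun hc =>
    hwne (hwz.antisymm (((move_le_move_iff h hm).2 hc).trans hmw))
  have hl₁ := hm.lt_val
  have hp₁ := hm.lt_pos
  rcases hr.2.2.1.eq_or_lt with ha | ha
  · obtain ⟨p', q', b', c1, c2, c3, c4⟩ := ih _ (by omega) hm rfl
    exact ⟨p', q', b', c1, by omega, by omega, c4.trans (hmw.trans hwz)⟩
  · have hpp : p.val ≠ p₁.val := fun e => ha.ne (congrArg x (Fin.ext e))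
    have hm' : IsMove x p p₁ (x p₁) := ⟨ha, hx.1 _, by omega, Or.inl ⟨p₁.2, rfl⟩⟩
    obtain ⟨p', q', b', c1, c2, c3, c4⟩ := ih _ (by omega) hm' rfl
    exact ⟨p', q', b', c1, c2, by omega, c4.trans ((move_le_move_iff hm' h).2 (by omega))⟩

/-- Covering moves with the same label coincide. -/
theorem IsCoverMove.eq_of_label_eq {x : Fin n → ℕ} (hx : IsRook n x) {p p' : Fin n}
    {q q' b b' : ℕ} (h : IsCoverMove x p q b) (h' : IsCoverMove x p' q' b') (ha : x p = x p')
    (hb : b = b') : move x p q b = move x p' q' b' := by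
  subst hb
  have hl := h.lt_val
  have hq : q = q' := by
    rcases h.loc with ⟨hq, e⟩ | ⟨rfl, e⟩ <;> rcases h'.loc with ⟨hq', e'⟩ | ⟨rfl, e'⟩
    · have := hx.2 ⟨q, hq⟩ ⟨q', hq'⟩ (by omega) (by omega)
      simpa using this
    · exact absurd e (e' _)
    · exact absurd e' (e _)
    · rfl
  subst hq
  have hp : p = p' := by
    rcases le_total p.val p'.val with hpp | hpp
    · have := h.move_eq hx h'.toIsMove ⟨hpp, le_rfl, ha.le, le_rfl⟩
      exact Fin.ext (by omega)
    · have := h'.move_eq hx h.toIsMove ⟨hpp, le_rfl, ha.ge, le_rfl⟩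
      exact Fin.ext (by omega)
  rw [hp]

theorem flabel_move {x : Fin n → ℕ} {p : Fin n} {q b : ℕ} (h : IsMove x p q b) :
    Flabel x (move x p q b) = (x p, b) := by
  have hl := h.lt_val
  have hp := h.lt_pos
  have hmp := move_self x p q b
  unfold Flabel
  split_ifs with h1 h2
  · obtain ⟨-, h4⟩ := h1.choose_spec
    have e : p = h1.choose := by
      by_contra hne
      have := h4 p hne
      omega
    rw [← e, hmp]
  · obtain ⟨c1, c2, c3, c4, c5⟩ := h2.choose_spec
    generalize h2.choose = r at c1 c2 c3 c4 c5
    have e1 : r.1 = p := by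
      by_contra hne
      by_cases hr : r.1.val = q
      · simp only [move, if_neg hne, if_pos hr] at c3
        rcases h.loc with ⟨hq, e⟩ | ⟨hq, -⟩
        · have : x r.1 = b := e ▸ congrArg x (Fin.ext hr)
          omega
        · have := r.1.2
          omega
      · simp only [move, if_neg hne, if_neg hr] at c3
        omega
    rw [e1, ← c3, e1, hmp]
  · exfalso
    rcases h.loc with ⟨hq, e⟩ | ⟨rfl, -⟩
    · have hqp : (⟨q, hq⟩ : Fin n) ≠ p := fun e' => by
        have := congrArg Fin.val e'
        simp only at this
        omega
      refine h2 ⟨(p, ⟨q, hq⟩), hp, by simp only [e]; exact hl, by simp only [e, hmp],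
        by simp [move, hqp], fun k k1 k2 => ?_⟩
      have k2' : k.val ≠ q := fun e' => k2 (Fin.ext e')
      simp [move, k1, k2']
    · refine h1 ⟨p, by rw [hmp]; exact hl, fun j hj => ?_⟩
      simp [move, hj, j.2.ne]

theorem step_move {x : Fin n → ℕ} {p : Fin n} {q b : ℕ} (h : IsMove x p q b) :
    Step1 x (move x p q b) ∨ Step2 x (move x p q b) := by
  have hl := h.lt_val
  have hp := h.lt_pos
  have hmp := move_self x p q b
  rcases h.loc with ⟨hq, e⟩ | ⟨rfl, -⟩
  · have hqp : (⟨q, hq⟩ : Fin n) ≠ p := fun e' => by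
      have := congrArg Fin.val e'
      simp only at this
      omega
    refine Or.inr ⟨p, ⟨q, hq⟩, hp, by omega, by rw [hmp, e], by simp [move, hqp],
      fun k k1 k2 => ?_⟩
    have k2' : k.val ≠ q := fun e' => k2 (Fin.ext e')
    simp [move, k1, k2']
  · refine Or.inl ⟨p, by rw [hmp]; exact hl, fun j hj => ?_⟩
    simp [move, hj, j.2.ne]

theorem exists_move_of_step {x z : Fin n → ℕ} (hx : IsRook n x) (hz : IsRook n z)
    (h : Step1 x z ∨ Step2 x z) : ∃ p q b, IsMove x p q b ∧ z = move x p q b := by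
  rcases h with ⟨p, hp, heq⟩ | ⟨p, q, hpq, hlt, hzp, hzq, heq⟩
  · refine ⟨p, n, z p, ⟨hp, hz.1 p, p.2, Or.inr ⟨rfl, fun j hj => ?_⟩⟩, ?_⟩
    · by_cases hjp : j = p
      · subst hjp
        omega
      · exact hjp (hz.2 j p (by rw [← heq j hjp]; omega) (by rw [← heq j hjp, hj]))
    · funext j
      by_cases hjp : j = p
      · rw [hjp, move_self]
      · simp [move, hjp, j.2.ne, heq j hjp]
  · refine ⟨p, q, x q, ⟨hlt, hx.1 q, hpq, Or.inl ⟨q.2, rfl⟩⟩, ?_⟩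
    funext j
    by_cases hjp : j = p
    · rw [hjp, move_self, hzp]
    · by_cases hjq : j = q
      · simp [move, hjq, hzq, hpq.ne']
      · have hjq' : j.val ≠ q.val := fun e => hjq (Fin.ext e)
        simp [move, hjp, hjq', heq j hjp hjq]

theorem RookLe.isRook {x y : Fin n → ℕ} (h : RookLe n x y) (hx : IsRook n x) : IsRook n y := by
  induction h with
  | refl => exact hx
  | tail _ h _ => exact h.2.1

theorem RookLe.rankLe {x y : Fin n → ℕ} (h : RookLe n x y) : RankLe x y := by
  induction h with
  | refl => exact RankLe.refl x
  | tail _ h ih =>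
    obtain ⟨p, q, b, hm, rfl⟩ := exists_move_of_step h.1 h.2.1 h.2.2
    exact ih.trans (rankLe_move hm)

/-- The sum of all ranks, strictly increasing along moves. -/
def totalRank (x : Fin n → ℕ) : ℕ :=
  ∑ s ∈ range (n + 1) ×ˢ range (n + 1), rookRank x s.1 s.2

theorem totalRank_mono {x y : Fin n → ℕ} (h : RankLe x y) : totalRank x ≤ totalRank y :=
  Finset.sum_le_sum fun s hs => h _ _ (by simp at hs; omega)

theorem totalRank_lt {x : Fin n → ℕ} {p : Fin n} {q b : ℕ} (h : IsMove x p q b) :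
    totalRank x < totalRank (move x p q b) := by
  have h1 := h.pos_le
  have h2 := h.val_le
  refine Finset.sum_lt_sum (fun s hs => rankLe_move h _ _ (by simp at hs; omega))
    ⟨(q, b), by simp; omega, ?_⟩
  exact rookRank_lt_of_move_le h (RankLe.refl _) h.lt_pos le_rfl h.lt_val le_rfl

/-- The tableau criterion for the Bruhat–Chevalley–Renner order. -/
theorem rookLe_iff_rankLe {x y : Fin n → ℕ} (hx : IsRook n x) (hy : IsRook n y) :
    RookLe n x y ↔ RankLe x y := by
  refine ⟨RookLe.rankLe, fun hle => ?_⟩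
  induction hN : totalRank y - totalRank x using Nat.strong_induction_on generalizing x with
  | _ N ih =>
  by_cases hne : x = y
  · subst hne
    exact Relation.ReflTransGen.refl
  obtain ⟨p, q, b, hm, hmy, -⟩ := exists_move hx hy hle hne
  have h1 := totalRank_lt hm
  have h2 := totalRank_mono hmy
  have hr := isRook_move hx hm
  exact (ih _ (by omega) hr hmy rfl).head ⟨hx, hr, step_move hm⟩

theorem rookCov_iff {x z : Fin n → ℕ} (hx : IsRook n x) :
    RookCov n x z ↔ ∃ p q b, IsCoverMove x p q b ∧ z = move x p q b := by
  constructor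
  · rintro ⟨⟨hle, hne⟩, hcov⟩
    have hz := hle.isRook hx
    have hcov' : ∀ w, IsRook n w → RankLe x w → RankLe w z → w = x ∨ w = z := by
      intro w hw hxw hwz
      by_contra! hcon
      exact hcov w ⟨(rookLe_iff_rankLe hx hw).2 hxw, hcon.1.symm⟩
        ⟨(rookLe_iff_rankLe hw hz).2 hwz, hcon.2⟩
    obtain ⟨p, q, b, hm, hmz, -⟩ := exists_move hx hz hle.rankLe hne
    rcases hcov' _ (isRook_move hx hm) (rankLe_move hm) hmz with e | e
    · exact absurd e (move_ne hm)
    · subst e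
      exact ⟨p, q, b, ⟨hm, hcov'⟩, rfl⟩
  · rintro ⟨p, q, b, hm, rfl⟩
    have hr := isRook_move hx hm.toIsMove
    refine ⟨⟨(rookLe_iff_rankLe hx hr).2 (rankLe_move hm.toIsMove), (move_ne hm.toIsMove).symm⟩,
      fun w hxw hwz => ?_⟩
    rcases hm.eq_or_eq w (hxw.1.isRook hx) hxw.1.rankLe hwz.1.rankLe with e | e
    · exact hxw.2 e.symm
    · exact hwz.2 e

theorem labels_cons_cons (x z : Fin n → ℕ) (t : List (Fin n → ℕ)) :
    labels (x :: z :: t) = Flabel x z :: labels (z :: t) := rfl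

theorem rookMaxChain_iff {x y : Fin n → ℕ} {c : List (Fin n → ℕ)} :
    RookMaxChain n x y c ↔ c.IsChain (RookCov n) ∧ c.head? = some x ∧ c.getLast? = some y :=
  Iff.rfl

theorem rookMaxChain_singleton {x y w : Fin n → ℕ} :
    RookMaxChain n x y [w] ↔ w = x ∧ w = y := by
  simp [rookMaxChain_iff]

theorem rookMaxChain_cons_cons {x y w z : Fin n → ℕ} {t : List (Fin n → ℕ)} :
    RookMaxChain n x y (w :: z :: t) ↔ w = x ∧ RookCov n w z ∧ RookMaxChain n z y (z :: t) := by
  simp only [rookMaxChain_iff, List.isChain_cons_cons, List.head?_cons, Option.some.injEq,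
    List.getLast?_cons_cons, true_and]
  tauto

theorem RookMaxChain.exists_eq_cons {x y : Fin n → ℕ} {c : List (Fin n → ℕ)}
    (h : RookMaxChain n x y c) : ∃ t, c = x :: t := by
  rcases c with _ | ⟨w, t⟩
  · simp [RookMaxChain] at h
  · have := h.2.1
    simp only [List.head?_cons, Option.some.injEq] at this
    exact ⟨t, by rw [this]⟩

theorem RookMaxChain.rookLe {x y : Fin n → ℕ} {t : List (Fin n → ℕ)}
    (h : RookMaxChain n x y (x :: t)) : RookLe n x y := by
  induction t generalizing x with
  | nil =>
    rw [(rookMaxChain_singleton.1 h).2]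
    exact Relation.ReflTransGen.refl
  | cons z t ih =>
    obtain ⟨-, h1, h2⟩ := rookMaxChain_cons_cons.1 h
    exact h1.1.1.trans (ih h2)

theorem RookMaxChain.eq_singleton {x : Fin n → ℕ} {c : List (Fin n → ℕ)}
    (h : RookMaxChain n x x c) : c = [x] := by
  obtain ⟨_ | ⟨z, t⟩, rfl⟩ := h.exists_eq_cons
  · rfl
  · obtain ⟨-, h1, h2⟩ := rookMaxChain_cons_cons.1 h
    exact absurd (h1.1.1.rankLe.antisymm h2.rookLe.rankLe) h1.1.2

/-- Along an increasing chain all of whose labels exceed `(a, b)`, where `b` sits at position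
`q`, no entry `a` leaves the positions before `q`. -/
theorem rookRank_le_of_increasing {y : Fin n → ℕ} {q a b : ℕ} (hq : q ≤ n) (hab : a < b)
    (hb : b ≤ n) {t : List (Fin n → ℕ)} {z : Fin n → ℕ} (hz : IsRook n z)
    (hc : RookMaxChain n z y (z :: t)) (hinc : (labels (z :: t)).IsChain pairLe)
    (hhead : ∀ l ∈ (labels (z :: t)).head?, pairLt (a, b) l ∧ (a < l.1 ∨ IsLoc z q b)) :
    rookRank y q (a + 1) ≤ rookRank z q (a + 1) := by
  induction t generalizing z with
  | nil => rw [(rookMaxChain_singleton.1 hc).2]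
  | cons z' t ih =>
    obtain ⟨-, hcov, hc'⟩ := rookMaxChain_cons_cons.1 hc
    obtain ⟨p₁, q₁, b₁, hm, rfl⟩ := (rookCov_iff hz).1 hcov
    have hm' := hm.toIsMove
    have hl₁ := hm'.lt_val
    have hp₁ := hm'.lt_pos
    have hq₁ := hm'.pos_le
    rw [labels_cons_cons, flabel_move hm'] at hhead hinc
    obtain ⟨hgt, hor⟩ := hhead _ rfl
    simp only [pairLt] at hgt hor
    have hout : ¬ (p₁.val < q ∧ q ≤ q₁ ∧ z p₁ < a + 1 ∧ a + 1 ≤ b₁) := by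
      rintro ⟨h1, h2, h3, h4⟩
      have hw : IsMove z p₁ q b := ⟨by omega, hb, h1, hor.resolve_left (by omega)⟩
      have := hm.move_eq hz hw (by omega)
      omega
    have hrank : rookRank (move z p₁ q₁ b₁) q (a + 1) = rookRank z q (a + 1) := by
      rw [rookRank_move hm' hq, if_neg hout, add_zero]
    rw [← hrank]
    refine ih (isRook_move hz hm') hc' hinc.of_cons fun l hl => ?_
    rcases hlab : labels (move z p₁ q₁ b₁ :: t) with _ | ⟨l', L⟩
    · simp [hlab] at hl
    rw [hlab, List.head?_cons, Option.mem_some_iff] at hl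
    subst hl
    rw [hlab, List.isChain_cons_cons] at hinc
    have hle := hinc.1
    simp only [pairLe, pairLt, Prod.ext_iff] at hle ⊢
    refine ⟨by omega, ?_⟩
    rcases hor with hlt | hloc
    · left; omega
    by_cases hlt : a < z p₁
    · left; omega
    right
    rcases hloc with ⟨hqn, e⟩ | ⟨rfl, e⟩
    · refine Or.inl ⟨hqn, ?_⟩
      have h1 : (⟨q, hqn⟩ : Fin n) ≠ p₁ := by
        rintro rfl
        omega
      have h2 : q ≠ q₁ := by
        rintro rfl
        omega
      simp only [move, if_neg h1, if_neg h2, e]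
    · refine Or.inr ⟨rfl, fun j => ?_⟩
      have := e j
      simp only [move]
      split_ifs <;> omega

theorem not_pairLt_of_increasing {x y z w : Fin n → ℕ} {t : List (Fin n → ℕ)}
    (hx : IsRook n x) (hc : RookMaxChain n x y (x :: z :: t))
    (hinc : (labels (x :: z :: t)).IsChain pairLe) (hw : RookCov n x w) (hwy : RookLe n w y) :
    ¬ pairLt (Flabel x w) (Flabel x z) := by
  intro hlt
  obtain ⟨p, q, b, hm, rfl⟩ := (rookCov_iff hx).1 hw
  have hm' := hm.toIsMove
  rw [flabel_move hm'] at hlt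
  have h1 := rookRank_le_of_increasing hm'.pos_le hm'.lt_val hm'.val_le hx hc hinc
    fun l hl => by
      rw [labels_cons_cons, List.head?_cons, Option.mem_some_iff] at hl
      exact ⟨hl ▸ hlt, Or.inr hm'.loc⟩
  exact absurd (rookRank_lt_of_move_le hm' hwy.rankLe (i := q) (k := x p + 1) hm'.lt_pos le_rfl
    (by omega) hm'.lt_val) (by omega)

/-- If a move raising the entry `x p` to `b` is followed by one raising an equal entry to a
smaller value, then the latter label is already available at `x`. -/
theorem exists_move_of_descent {x : Fin n → ℕ} {p p' : Fin n} {q q' b b' : ℕ}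
    (h : IsMove x p q b) (h' : IsMove (move x p q b) p' q' b')
    (ha : move x p q b p' = x p) (hb : b' < b) :
    ∃ r, IsMove x r q' b' ∧ x r = x p ∧
      RankLe (move x r q' b') (move (move x p q b) p' q' b') := by
  have hl := h.lt_val
  have hp := h.lt_pos
  have hl' := h'.lt_val
  have hp' := h'.lt_pos
  have hxb : ∀ j : Fin n, j.val = q → x j = b := by
    intro j hj
    rcases h.loc with ⟨hq, e⟩ | ⟨rfl, -⟩
    · exact e ▸ congrArg x (Fin.ext hj)
    · exact absurd hj j.2.ne
  have hpp : p' ≠ p := by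
    rintro rfl
    rw [move_self] at ha
    omega
  have hloc : IsLoc x q' b' := by
    rcases h'.loc with ⟨hq, e⟩ | ⟨rfl, e⟩
    · refine Or.inl ⟨hq, ?_⟩
      simp only [move] at e
      split_ifs at e <;> omega
    · refine Or.inr ⟨rfl, fun j hj => ?_⟩
      have h1 := e j
      have h2 := hxb j
      have h3 : j ≠ p := by
        rintro rfl
        omega
      simp only [move, if_neg h3] at h1
      split_ifs at h1 <;> omega
  by_cases hpq : p'.val = q
  · have hmv : IsMove x p q' b' := ⟨by omega, h'.val_le, by omega, hloc⟩
    refine ⟨p, hmv, rfl, fun i k hi => ?_⟩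
    rw [rookRank_move h' hi, rookRank_move h hi, rookRank_move hmv hi, ha]
    split_ifs <;> omega
  · have hxp : x p' = x p := by
      rw [← ha]
      simp [move, hpp, hpq]
    have hmv : IsMove x p' q' b' := ⟨by omega, h'.val_le, hp', hloc⟩
    refine ⟨p', hmv, hxp, fun i k hi => ?_⟩
    rw [rookRank_move h' hi, rookRank_move h hi, rookRank_move hmv hi, ha, hxp]
    split_ifs <;> omega

theorem exists_increasing_chain {x y : Fin n → ℕ} (hx : IsRook n x) (hy : IsRook n y)
    (hle : RankLe x y) :
    ∃ t, RookMaxChain n x y (x :: t) ∧ (labels (x :: t)).IsChain pairLe := by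
  classical
  induction hN : totalRank y - totalRank x using Nat.strong_induction_on generalizing x with
  | _ N ih =>
  by_cases hne : x = y
  · exact ⟨[], rookMaxChain_singleton.2 ⟨rfl, hne⟩, by simp [labels]⟩
  obtain ⟨p₀, q₀, b₀, hm₀, hmy₀, hlow⟩ := exists_move hx hy hle hne
  have hcover : ∀ {p q b}, IsMove x p q b → x p = x p₀ → RankLe (move x p q b) y →
      ∃ b' ≤ b, ∃ p q, IsCoverMove x p q b' ∧ x p = x p₀ ∧ RankLe (move x p q b') y := by
    intro p q b hm hp hmy
    obtain ⟨p', q', b', c1, c2, c3, c4⟩ := exists_coverMove hx hm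
    exact ⟨b', c3, p', q', c1, by omega, c4.trans hmy⟩
  have hex : ∃ b p q, IsCoverMove x p q b ∧ x p = x p₀ ∧ RankLe (move x p q b) y := by
    obtain ⟨b, -, h⟩ := hcover hm₀ rfl hmy₀
    exact ⟨b, h⟩
  obtain ⟨b, ⟨p, q, hm, hp, hmy⟩, hmin⟩ : ∃ b, (∃ p q, IsCoverMove x p q b ∧ x p = x p₀ ∧
      RankLe (move x p q b) y) ∧ ∀ b' < b, ¬ ∃ p q, IsCoverMove x p q b' ∧ x p = x p₀ ∧
      RankLe (move x p q b') y :=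
    ⟨Nat.find hex, Nat.find_spec hex, fun m => Nat.find_min hex⟩
  have hm' := hm.toIsMove
  have hr := isRook_move hx hm'
  have hT := totalRank_lt hm'
  have hT' := totalRank_mono hmy
  obtain ⟨t, hc, hinc⟩ := ih _ (by omega) hr hmy rfl
  refine ⟨move x p q b :: t,
    rookMaxChain_cons_cons.2 ⟨rfl, (rookCov_iff hx).2 ⟨p, q, b, hm, rfl⟩, hc⟩, ?_⟩
  rw [labels_cons_cons, flabel_move hm']
  rcases t with _ | ⟨w, t⟩
  · simp [labels]
  rw [labels_cons_cons] at hinc ⊢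
  refine List.isChain_cons_cons.2 ⟨?_, hinc⟩
  obtain ⟨-, hcov, hc'⟩ := rookMaxChain_cons_cons.1 hc
  obtain ⟨p', q', b', hcm, rfl⟩ := (rookCov_iff hr).1 hcov
  have hcm' := hcm.toIsMove
  have hwy := hc'.rookLe.rankLe
  rw [flabel_move hcm']
  have ha : x p ≤ move x p q b p' := by
    by_contra! hlt
    have h1 := rookRank_lt_of_move_le hcm' hwy (i := p' + 1) (k := move x p q b p' + 1)
      (by omega) hcm'.lt_pos (by omega) hcm'.lt_val
    have h2 := hlow (p' + 1) (move x p q b p' + 1) p'.2 (by omega)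
    have h3 := rankLe_move hm' (p' + 1) (move x p q b p' + 1) p'.2
    omega
  have hb : move x p q b p' = x p → b ≤ b' := by
    intro e
    by_contra! hlt
    obtain ⟨r, hr1, hr2, hr3⟩ := exists_move_of_descent hm' hcm' e hlt
    obtain ⟨b₁, hb₁, h⟩ := hcover hr1 (hr2.trans hp) (hr3.trans hwy)
    exact hmin b₁ (by omega) h
  simp only [pairLe, pairLt, Prod.ext_iff]
  omega

theorem pairLt_trichotomy (l m : ℕ × ℕ) : pairLt l m ∨ l = m ∨ pairLt m l := by
  simp only [pairLt, Prod.ext_iff]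
  omega

/-- An increasing chain is lexicographically first, and is the only increasing chain. -/
theorem RookMaxChain.first_of_increasing {x y : Fin n → ℕ} {t : List (Fin n → ℕ)}
    (hx : IsRook n x) (hc : RookMaxChain n x y (x :: t))
    (hinc : (labels (x :: t)).IsChain pairLe) {d : List (Fin n → ℕ)}
    (hd : RookMaxChain n x y d) :
    lexLe (labels (x :: t)) (labels d) ∧ ((labels d).IsChain pairLe → d = x :: t) := by
  induction t generalizing x d with
  | nil =>
    obtain ⟨-, rfl⟩ := rookMaxChain_singleton.1 hc
    rw [hd.eq_singleton]
    exact ⟨Or.inl rfl, fun _ => rfl⟩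
  | cons z t ih =>
    obtain ⟨_ | ⟨w, s⟩, rfl⟩ := hd.exists_eq_cons
    · obtain ⟨-, rfl⟩ := rookMaxChain_singleton.1 hd
      exact absurd hc.eq_singleton (by simp)
    obtain ⟨-, hxz, hzy⟩ := rookMaxChain_cons_cons.1 hc
    obtain ⟨-, hxw, hwy⟩ := rookMaxChain_cons_cons.1 hd
    have hnot := not_pairLt_of_increasing hx hc hinc hxw hwy.rookLe
    rcases pairLt_trichotomy (Flabel x z) (Flabel x w) with hlt | heq | hgt
    · refine ⟨Or.inr (List.Lex.rel hlt), fun hdinc => ?_⟩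
      exact absurd hlt (not_pairLt_of_increasing hx hd hdinc hxz hzy.rookLe)
    · have hzw : z = w := by
        obtain ⟨p, q, b, hm, rfl⟩ := (rookCov_iff hx).1 hxz
        obtain ⟨p', q', b', hm', rfl⟩ := (rookCov_iff hx).1 hxw
        rw [flabel_move hm.toIsMove, flabel_move hm'.toIsMove, Prod.mk.injEq] at heq
        exact hm.eq_of_label_eq hx hm' heq.1 heq.2
      subst hzw
      rw [labels_cons_cons, labels_cons_cons] at *
      obtain ⟨h1, h2⟩ := ih (hxz.1.1.isRook hx) hzy hinc.of_cons hwy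
      refine ⟨?_, fun hdinc => by rw [h2 hdinc.of_cons]⟩
      rcases h1 with h1 | h1
      · exact Or.inl (by rw [h1])
      · exact Or.inr (List.Lex.cons h1)
    · exact absurd hgt hnot

theorem rook_monoid_EL_shellable (n : ℕ) (x y : Fin n → ℕ)
    (hx : IsRook n x) (hy : IsRook n y) (hle : RookLe n x y) :
    ∃ c : List (Fin n → ℕ),
      (RookMaxChain n x y c ∧ (labels c).Chain' pairLe) ∧
      (∀ d, RookMaxChain n x y d ∧ (labels d).Chain' pairLe → d = c) ∧
      (∀ d, RookMaxChain n x y d → lexLe (labels c) (labels d)) := by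
  obtain ⟨t, hc, hinc⟩ := exists_increasing_chain hx hy hle.rankLe
  exact ⟨x :: t, ⟨hc, hinc⟩, fun d hd => (hc.first_of_increasing hx hinc hd.1).2 hd.2,
    fun d hd => (hc.first_of_increasing hx hinc hd).1⟩
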